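/- Let k = r + s ≥ 3 be odd with r, s ≥ 1. Then ζ(r̄, s̄) = -(1/2)ζ(k) + ((1+(-1)^s)/2)ζ(r̄)ζ(s̄) + (-1)^r Σ_{l=0}^{(k-1)/2} [C(k-2l-1, r-1) + C(k-2l-1, s-1)] ζ(overline{k-2l}) ζ(2l), with the convention ζ(0) = -1/2. -/

import Mathlib

open Filter Finset Real

/-- `zeta k` : the Riemann zeta value `ζ(k) = Σ_{m≥1} 1/m^k`, with the convention `ζ(0) = -1/2`. -/
noncomputable def zeta (k : ℕ) : ℝ :=
  if k = 0 then -1/2 else limUnder atTop (fun N => ∑ m ∈ Finset.range N, 1/((m+1 : ℝ))^k)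

/-- `zetaA k` : the alternating zeta value `ζ(k̄) = Σ_{m≥1} (-1)^m/m^k`,
with the convention `ζ(0̄) = -1/2`. -/
noncomputable def zetaA (k : ℕ) : ℝ :=
  if k = 0 then -1/2 else
    limUnder atTop (fun N => ∑ m ∈ Finset.range N, (-1 : ℝ)^(m+1)/((m+1 : ℝ))^k)

/-- `dzeta r s = ζ(r,s) = Σ_{m≥2} (1/m^s) Σ_{j=1}^{m-1} 1/j^r`. -/
noncomputable def dzeta (r s : ℕ) : ℝ :=
  limUnder atTop (fun N => ∑ m ∈ Finset.range N,
    (1/((m+2 : ℝ))^s) * ∑ j ∈ Finset.range (m+1), 1/((j+1 : ℝ))^r)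

/-- `dzetaA1 r s = ζ(r̄,s) = Σ_{m≥2} (1/m^s) Σ_{j=1}^{m-1} (-1)^j/j^r`. -/
noncomputable def dzetaA1 (r s : ℕ) : ℝ :=
  limUnder atTop (fun N => ∑ m ∈ Finset.range N,
    (1/((m+2 : ℝ))^s) * ∑ j ∈ Finset.range (m+1), (-1 : ℝ)^(j+1)/((j+1 : ℝ))^r)

/-- `dzetaA2 r s = ζ(r,s̄) = Σ_{m≥2} ((-1)^m/m^s) Σ_{j=1}^{m-1} 1/j^r`. -/
noncomputable def dzetaA2 (r s : ℕ) : ℝ :=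
  limUnder atTop (fun N => ∑ m ∈ Finset.range N,
    ((-1 : ℝ)^(m+2)/((m+2 : ℝ))^s) * ∑ j ∈ Finset.range (m+1), 1/((j+1 : ℝ))^r)

/-- `dzetaA3 r s = ζ(r̄,s̄) = Σ_{m≥2} ((-1)^m/m^s) Σ_{j=1}^{m-1} (-1)^j/j^r`. -/
noncomputable def dzetaA3 (r s : ℕ) : ℝ :=
  limUnder atTop (fun N => ∑ m ∈ Finset.range N,
    ((-1 : ℝ)^(m+2)/((m+2 : ℝ))^s) * ∑ j ∈ Finset.range (m+1), (-1 : ℝ)^(j+1)/((j+1 : ℝ))^r)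

open Topology

/-- The `j`-th term `(-1)^(j+1) / (j+1)^r` of the alternating zeta series. -/
noncomputable def altTerm (r j : ℕ) : ℝ := (-1 : ℝ) ^ (j + 1) / ((j : ℝ) + 1) ^ r

/-- Partial sums of the alternating zeta series. -/
noncomputable def altSum (r N : ℕ) : ℝ := ∑ j ∈ range N, altTerm r j

lemma altSum_succ (r N : ℕ) : altSum r (N + 1) = altSum r N + altTerm r N :=
  Finset.sum_range_succ _ _

/-- Partial sums of the double series defining `dzetaA3`. -/
noncomputable def altDoubleSum (r s N : ℕ) : ℝ :=
  ∑ m ∈ range N, altTerm s (m + 1) * altSum r (m + 1)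

/-- The polar part at `x = 0` of the partial fraction expansion of `x⁻¹ ^ r * (x + c)⁻¹ ^ s`. -/
noncomputable def polarPart (r s : ℕ) (c x : ℝ) : ℝ :=
  ∑ t ∈ range r, (-1 : ℝ) ^ t * (s.multichoose t : ℝ) * c⁻¹ ^ (s + t) * x⁻¹ ^ (r - t)

lemma polarPart_zero_right {r : ℕ} (hr : 1 ≤ r) (c x : ℝ) : polarPart r 0 c x = x⁻¹ ^ r := by
  obtain ⟨r, rfl⟩ := Nat.exists_eq_add_of_le' hr
  simp [polarPart, Finset.sum_range_succ']

lemma mul_polarPart_succ_succ (r s : ℕ) {c : ℝ} (hc : c ≠ 0) (x : ℝ) :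
    c * polarPart (r + 1) (s + 1) c x
      = polarPart (r + 1) s c x - polarPart r (s + 1) c x := by
  unfold polarPart
  rw [Finset.sum_range_succ' _ r, Finset.sum_range_succ' _ r, mul_add, Finset.mul_sum,
    add_sub_right_comm, ← Finset.sum_sub_distrib]
  congr 1
  · refine Finset.sum_congr rfl fun t _ => ?_
    rw [Nat.multichoose_succ_succ, Nat.add_sub_add_right,
      show s + 1 + (t + 1) = s + t + 1 + 1 by ring,
      show s + (t + 1) = s + t + 1 by ring, show s + 1 + t = s + t + 1 by ring]
    push_cast
    rw [pow_succ c⁻¹ (s + t + 1)]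
    field_simp
    ring
  · simp only [Nat.multichoose_zero_right, pow_zero, add_zero, pow_succ c⁻¹ s]
    field_simp

/-- Partial fraction expansion of `1 / (x ^ r * y ^ s)` with respect to `y - x = c`. -/
lemma inv_pow_mul_inv_pow_eq_polarPart {c x y : ℝ} (hc : c ≠ 0) (hx : x ≠ 0) (hy : y ≠ 0)
    (hxy : y - x = c) (r s : ℕ) (hrs : 1 ≤ r + s) :
    x⁻¹ ^ r * y⁻¹ ^ s = polarPart r s c x + polarPart s r (-c) y := by
  induction r generalizing s with
  | zero => rw [polarPart_zero_right (by omega)]; simp [polarPart]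
  | succ r ihr =>
    induction s with
    | zero => rw [polarPart_zero_right (by omega)]; simp [polarPart]
    | succ s ihs =>
      have h₁ := ihs (by omega)
      have h₂ := ihr (s + 1) (by omega)
      have h₃ := mul_polarPart_succ_succ r s hc x
      have h₄ := mul_polarPart_succ_succ s r (neg_ne_zero.2 hc) y
      apply mul_left_cancel₀ hc
      have h₅ : c * (x⁻¹ ^ (r + 1) * y⁻¹ ^ (s + 1))
          = x⁻¹ ^ (r + 1) * y⁻¹ ^ s - x⁻¹ ^ r * y⁻¹ ^ (s + 1) := by
        rw [← hxy, pow_succ x⁻¹ r, pow_succ y⁻¹ s]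
        field_simp
      linear_combination h₅ + h₁ - h₂ - h₃ + h₄

lemma sum_range_multichoose_eq_choose (r s : ℕ) (hs : 1 ≤ s) :
    ∑ t ∈ range s, r.multichoose t = (r + s - 1).choose (s - 1) := by
  obtain ⟨s, rfl⟩ := Nat.exists_eq_add_of_le' hs
  rw [Nat.sum_range_multichoose, Nat.choose_symm_add.symm]
  congr 1; omega

lemma polarPart_neg_self {r s : ℕ} (hr : 1 ≤ r) (c : ℝ) :
    polarPart r s c (-c) = (-1) ^ r * ((r + s - 1).choose (r - 1) : ℝ) * c⁻¹ ^ (r + s) := by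
  rw [add_comm r s, ← sum_range_multichoose_eq_choose s r hr, polarPart, Nat.cast_sum,
    Finset.mul_sum, Finset.sum_mul]
  refine Finset.sum_congr rfl fun t ht => ?_
  obtain ⟨u, rfl⟩ := Nat.exists_eq_add_of_le (Finset.mem_range.1 ht).le
  rw [Nat.add_sub_cancel_left, inv_neg, neg_pow]
  ring

lemma summable_inv_succ_pow {i : ℕ} (hi : 2 ≤ i) :
    Summable fun j : ℕ => ((j : ℝ) + 1)⁻¹ ^ i := by
  have := (summable_nat_add_iff 1).2 (Real.summable_nat_pow_inv.2 (show 1 < i by omega))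
  simpa using this

lemma tendsto_sum_zeta {k : ℕ} (hk : 2 ≤ k) :
    Tendsto (fun N => ∑ j ∈ range N, ((j : ℝ) + 1)⁻¹ ^ k) atTop (𝓝 (zeta k)) := by
  have h := (summable_inv_succ_pow hk).hasSum.tendsto_sum_nat
  have : zeta k = ∑' j : ℕ, ((j : ℝ) + 1)⁻¹ ^ k := by
    rw [zeta, if_neg (by omega), ← h.limUnder_eq]
    simp
  rwa [this]

lemma tendsto_altSum {k : ℕ} (hk : 1 ≤ k) : Tendsto (altSum k) atTop (𝓝 (zetaA k)) := by
  have hanti : Antitone fun j : ℕ => 1 / ((j : ℝ) + 1) ^ k := fun a b hab => by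
    dsimp only; gcongr
  have h0 : Tendsto (fun j : ℕ => 1 / ((j : ℝ) + 1) ^ k) atTop (𝓝 0) := by
    have := (tendsto_one_div_add_atTop_nhds_zero_nat (𝕜 := ℝ)).pow k
    simpa [div_pow, show k ≠ 0 by omega] using this
  obtain ⟨l, hl⟩ := hanti.tendsto_alternating_series_of_tendsto_zero h0
  have h : Tendsto (altSum k) atTop (𝓝 (-l)) := by
    refine hl.neg.congr fun N => ?_
    rw [altSum, ← Finset.sum_neg_distrib]
    refine Finset.sum_congr rfl fun j _ => ?_
    rw [altTerm]; ring
  have : zetaA k = -l := by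
    rw [zetaA, if_neg (by omega), ← h.limUnder_eq]
    rfl
  rwa [this]

lemma altDoubleSum_add_swap (r s N : ℕ) :
    altDoubleSum r s N + altDoubleSum s r N + ∑ j ∈ range (N + 1), ((j : ℝ) + 1)⁻¹ ^ (r + s)
      = altSum r (N + 1) * altSum s (N + 1) := by
  have key (m : ℕ) : altTerm r m * altTerm s m = ((m : ℝ) + 1)⁻¹ ^ (r + s) := by
    have : ((-1 : ℝ) ^ (m + 1)) * (-1) ^ (m + 1) = 1 := by rw [← mul_pow]; simp
    rw [altTerm, altTerm, div_mul_div_comm, this, ← pow_add, inv_pow, one_div]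
  induction N with
  | zero => simp [altDoubleSum, altSum, ← key]
  | succ N ih =>
    simp only [altDoubleSum] at ih ⊢
    rw [Finset.sum_range_succ _ N, Finset.sum_range_succ _ N, Finset.sum_range_succ _ (N + 1),
      altSum_succ r (N + 1), altSum_succ s (N + 1), ← key]
    linear_combination ih

lemma altDoubleSum_add_sum (r s N : ℕ) :
    altDoubleSum r s N + ∑ j ∈ range (N + 1), altTerm r j * altSum s (j + 1)
      = altSum r (N + 1) * altSum s (N + 1) := by
  induction N with
  | zero => simp [altDoubleSum, altSum]
  | succ N ih =>
    simp only [altDoubleSum] at ih ⊢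
    rw [Finset.sum_range_succ _ N, Finset.sum_range_succ _ (N + 1)]
    rw [altSum_succ r (N + 1), altSum_succ s (N + 1)]
    linear_combination ih

lemma sum_range_alternating_mem_Icc {f : ℕ → ℝ} (hf : Antitone f) (h0 : ∀ n, 0 ≤ f n) (N : ℕ) :
    ∑ n ∈ range N, (-1 : ℝ) ^ n * f n ∈ Set.Icc 0 (f 0) := by
  induction N generalizing f with
  | zero => simpa using h0 0
  | succ N ih =>
    have h := ih (f := fun n => f (n + 1)) (fun a b hab => hf (by omega)) (fun n => h0 _)
    have h1 : f 1 ≤ f 0 := hf (by omega)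
    have : ∑ n ∈ range (N + 1), (-1 : ℝ) ^ n * f n
        = f 0 - ∑ n ∈ range N, (-1 : ℝ) ^ n * f (n + 1) := by
      rw [Finset.sum_range_succ', sub_eq_add_neg, ← Finset.sum_neg_distrib, add_comm]
      simp [pow_succ]
    rw [this]
    simp only [Set.mem_Icc, zero_add] at h ⊢
    constructor <;> linarith [h.1, h.2]

/-- **Mertens' theorem** on Cauchy products. -/
lemma tendsto_sum_cauchyProduct {f g : ℕ → ℝ} {F G : ℝ} (hf : Summable fun n => |f n|)
    (hF : Tendsto (fun N => ∑ n ∈ range N, f n) atTop (𝓝 F))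
    (hG : Tendsto (fun N => ∑ n ∈ range N, g n) atTop (𝓝 G)) :
    Tendsto (fun N => ∑ n ∈ range N, ∑ m ∈ range (n + 1), f m * g (n - m)) atTop
      (𝓝 (F * G)) := by
  have h := cauchy_product (abv := (abs : ℝ → ℝ)) (f := f) (g := g)
    (isCauSeq_iff_cauchySeq.2 hf.hasSum.tendsto_sum_nat.cauchySeq)
    (isCauSeq_iff_cauchySeq.2 hG.cauchySeq)
  have h0 : Tendsto (fun N => (∑ n ∈ range N, f n) * (∑ n ∈ range N, g n)
      - ∑ n ∈ range N, ∑ m ∈ range (n + 1), f m * g (n - m)) atTop (𝓝 0) := by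
    refine Metric.tendsto_atTop.2 fun ε hε => ?_
    obtain ⟨i, hi⟩ := h ε hε
    exact ⟨i, fun n hn => by simpa [Real.dist_eq] using hi n hn⟩
  simpa using (hF.mul hG).sub h0

lemma abs_altTerm (r j : ℕ) : |altTerm r j| = ((j : ℝ) + 1)⁻¹ ^ r := by
  have : (0 : ℝ) < (j : ℝ) + 1 := by positivity
  rw [altTerm, abs_div, abs_pow, abs_neg, abs_one, one_pow, abs_of_pos (by positivity), inv_pow,
    one_div]

lemma altTerm_eq (r j : ℕ) : altTerm r j = (-1) ^ (j + 1) * ((j : ℝ) + 1)⁻¹ ^ r := by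
  rw [altTerm, inv_pow, div_eq_mul_inv]

/-- The convolution `∑ 1 / (p ^ r * q ^ s)` over `p, q ≥ 1` with `p + q = n + 1`. -/
noncomputable def convSum (r s n : ℕ) : ℝ :=
  ∑ q ∈ range n, ((q : ℝ) + 1)⁻¹ ^ r * (((n - 1 - q : ℕ) : ℝ) + 1)⁻¹ ^ s

lemma tendsto_sum_convSum {r s : ℕ} (hr : 1 ≤ r) (hs : 1 ≤ s) (hrs : 3 ≤ r + s) :
    Tendsto (fun N => ∑ n ∈ range N, (-1 : ℝ) ^ (n + 1) * convSum r s n) atTop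
      (𝓝 (zetaA r * zetaA s)) := by
  rw [← tendsto_add_atTop_iff_nat 1]
  have hsum {i : ℕ} (hi : 2 ≤ i) : Summable fun n => |altTerm i n| := by
    simpa only [abs_altTerm] using summable_inv_succ_pow hi
  have key : Tendsto (fun N => ∑ n ∈ range N, ∑ m ∈ range (n + 1), altTerm r m * altTerm s (n - m))
      atTop (𝓝 (zetaA r * zetaA s)) := by
    rcases le_or_gt 2 r with h | h
    · exact tendsto_sum_cauchyProduct (hsum h) (tendsto_altSum hr) (tendsto_altSum hs)
    · rw [mul_comm]
      refine (tendsto_sum_cauchyProduct (hsum (i := s) (by omega)) (tendsto_altSum hs)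
        (tendsto_altSum hr)).congr fun N => Finset.sum_congr rfl fun n _ => ?_
      rw [← Finset.sum_range_reflect]
      refine Finset.sum_congr rfl fun m hm => ?_
      have : m < n + 1 := Finset.mem_range.1 hm
      rw [Nat.add_sub_cancel, Nat.sub_sub_self (by omega), mul_comm]
  refine key.congr fun N => ?_
  rw [Finset.sum_range_succ' _ N]
  simp only [convSum, Finset.range_zero, Finset.sum_empty, mul_zero, add_zero,
    Nat.add_sub_cancel, Finset.mul_sum]
  refine Finset.sum_congr rfl fun n _ => Finset.sum_congr rfl fun m hm => ?_
  obtain ⟨u, rfl⟩ := Nat.exists_eq_add_of_le (Nat.lt_succ_iff.1 (Finset.mem_range.1 hm))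
  rw [altTerm_eq, altTerm_eq, Nat.add_sub_cancel_left]
  ring

/-- The series `∑ 1 / (j ^ r * (j + n + 1) ^ s)` over `j ≥ 1`. -/
noncomputable def shiftedSum (r s n : ℕ) : ℝ :=
  ∑' j : ℕ, ((j : ℝ) + 1)⁻¹ ^ r * ((j : ℝ) + n + 2)⁻¹ ^ s

lemma inv_pow_mul_shift_le (r s n j : ℕ) :
    ((j : ℝ) + 1)⁻¹ ^ r * ((j : ℝ) + n + 2)⁻¹ ^ s ≤ ((j : ℝ) + 1)⁻¹ ^ (r + s) := by
  rw [pow_add]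
  have : (j : ℝ) + 1 ≤ (j : ℝ) + n + 2 := by
    have : (0 : ℝ) ≤ n := n.cast_nonneg
    linarith
  gcongr

lemma summable_shiftedSum {r s : ℕ} (hrs : 2 ≤ r + s) (n : ℕ) :
    Summable fun j : ℕ => ((j : ℝ) + 1)⁻¹ ^ r * ((j : ℝ) + n + 2)⁻¹ ^ s :=
  Summable.of_nonneg_of_le (fun j => by positivity) (inv_pow_mul_shift_le r s n)
    (summable_inv_succ_pow hrs)

lemma sum_alternating_shift (r s N j : ℕ) :
    ∑ n ∈ range N, (-1 : ℝ) ^ (n + 1) * (((j : ℝ) + 1)⁻¹ ^ r * ((j : ℝ) + n + 2)⁻¹ ^ s)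
      = altTerm r j * (altSum s (j + 1 + N) - altSum s (j + 1)) := by
  rw [altSum, altSum, Finset.sum_range_add, add_sub_cancel_left, Finset.mul_sum]
  refine Finset.sum_congr rfl fun n _ => ?_
  rw [altTerm_eq, altTerm_eq]
  have : (-1 : ℝ) ^ (j + 1) * (-1) ^ (j + 1) = 1 := by rw [← mul_pow]; simp
  push_cast
  rw [show (j : ℝ) + 1 + n + 1 = j + n + 2 by ring, show j + 1 + n + 1 = (j + 1) + (n + 1) by ring,
    pow_add (-1 : ℝ) (j + 1)]
  linear_combination (-(-1 : ℝ) ^ (n + 1) * (((j : ℝ) + 1)⁻¹ ^ r * ((j : ℝ) + n + 2)⁻¹ ^ s)) * this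

lemma abs_altTerm_mul_sub_le (r s N j : ℕ) :
    |altTerm r j * (altSum s (j + 1 + N) - altSum s (j + 1))| ≤ ((j : ℝ) + 1)⁻¹ ^ (r + s) := by
  refine le_trans ?_ (inv_pow_mul_shift_le r s 0 j)
  have h := sum_range_alternating_mem_Icc (f := fun n : ℕ => ((j : ℝ) + n + 2)⁻¹ ^ s)
    (fun a b hab => by dsimp only; gcongr) (fun n => by positivity) N
  have : ∑ n ∈ range N, (-1 : ℝ) ^ (n + 1) * (((j : ℝ) + 1)⁻¹ ^ r * ((j : ℝ) + n + 2)⁻¹ ^ s)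
      = -(((j : ℝ) + 1)⁻¹ ^ r * ∑ n ∈ range N, (-1 : ℝ) ^ n * ((j : ℝ) + n + 2)⁻¹ ^ s) := by
    rw [Finset.mul_sum, ← Finset.sum_neg_distrib]
    exact Finset.sum_congr rfl fun n _ => by ring
  rw [← sum_alternating_shift, this, abs_neg, abs_mul, abs_of_nonneg h.1,
    abs_of_nonneg (by positivity)]
  gcongr
  exact h.2

lemma tendsto_altDoubleSum_and_shiftedSum {r s : ℕ} (hr : 1 ≤ r) (hs : 1 ≤ s) :
    Tendsto (altDoubleSum r s) atTop (𝓝 (dzetaA3 r s)) ∧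
      Tendsto (fun N => ∑ n ∈ range N, (-1 : ℝ) ^ (n + 1) * shiftedSum r s n) atTop
        (𝓝 (dzetaA3 r s)) := by
  set g : ℕ → ℝ := fun j => altTerm r j * (zetaA s - altSum s (j + 1)) with hg
  have hbound := summable_inv_succ_pow (show 2 ≤ r + s by omega)
  have hlim (j : ℕ) : Tendsto (fun N => altTerm r j * (altSum s (j + 1 + N) - altSum s (j + 1)))
      atTop (𝓝 (g j)) := by
    refine (Tendsto.sub_const ?_ _).const_mul _
    simp_rw [add_comm (j + 1)]
    exact (tendsto_add_atTop_iff_nat (j + 1)).2 (tendsto_altSum hs)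
  have hgsum : Summable g := by
    refine Summable.of_norm_bounded hbound fun j => ?_
    exact le_of_tendsto (hlim j).norm (Eventually.of_forall fun N => abs_altTerm_mul_sub_le r s N j)
  have h₁ : Tendsto (fun N => ∑ n ∈ range N, (-1 : ℝ) ^ (n + 1) * shiftedSum r s n) atTop
      (𝓝 (∑' j, g j)) := by
    refine (tendsto_tsum_of_dominated_convergence hbound hlim
      (Eventually.of_forall fun N j => abs_altTerm_mul_sub_le r s N j)).congr fun N => ?_
    simp_rw [← sum_alternating_shift]
    rw [Summable.tsum_finsetSum fun n _ => (summable_shiftedSum (by omega) n).mul_left _]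
    exact Finset.sum_congr rfl fun n _ => tsum_mul_left
  have h₂ : Tendsto (altDoubleSum r s) atTop (𝓝 (∑' j, g j)) := by
    have ht := (tendsto_add_atTop_iff_nat 1).2 hgsum.hasSum.tendsto_sum_nat
    have ha := (tendsto_add_atTop_iff_nat 1).2 (tendsto_altSum hr)
    have hb := (tendsto_add_atTop_iff_nat 1).2 (tendsto_altSum hs)
    have := ht.add (ha.mul (hb.sub_const (zetaA s)))
    rw [sub_self, mul_zero, add_zero] at this
    refine this.congr fun N => ?_
    have hsplit : ∑ j ∈ range (N + 1), g j = altSum r (N + 1) * zetaA s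
        - ∑ j ∈ range (N + 1), altTerm r j * altSum s (j + 1) := by
      simp only [hg, mul_sub, Finset.sum_sub_distrib, altSum, Finset.sum_mul]
    linear_combination hsplit - altDoubleSum_add_sum r s N
  have h₃ : dzetaA3 r s = ∑' j, g j := by
    rw [dzetaA3, ← h₂.limUnder_eq]
    congr 1
    funext N
    refine Finset.sum_congr rfl fun m _ => ?_
    rw [altSum, altTerm]
    push_cast
    rw [show (m : ℝ) + 1 + 1 = m + 2 by ring]
    rfl
  rw [h₃]
  exact ⟨h₂, h₁⟩

/-- The principal value of `∑ 1 / j ^ i` over the nonzero integers `j`. -/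
noncomputable def evenZeta (i : ℕ) : ℝ := if Even i then 2 * zeta i else 0

lemma tendsto_principalValue {i : ℕ} (hi : 1 ≤ i) (n : ℕ) :
    Tendsto (fun M => ∑ j ∈ range M, ((j : ℝ) + 1)⁻¹ ^ i
      + (-1) ^ i * ∑ j ∈ range (M + n), ((j : ℝ) + 1)⁻¹ ^ i) atTop (𝓝 (evenZeta i)) := by
  rcases hi.eq_or_lt with rfl | hi
  · have h0 : Tendsto (fun M : ℕ => -∑ x ∈ range n, (((M + x : ℕ) : ℝ) + 1)⁻¹) atTop
        (𝓝 (-∑ x ∈ range n, (0 : ℝ))) := by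
      refine (tendsto_finsetSum _ fun x _ => ?_).neg
      have := (tendsto_add_atTop_iff_nat x).2 (tendsto_one_div_add_atTop_nhds_zero_nat (𝕜 := ℝ))
      simpa only [one_div] using this
    rw [Finset.sum_const_zero, neg_zero] at h0
    rw [evenZeta, if_neg (by decide)]
    refine h0.congr fun M => ?_
    rw [Finset.sum_range_add]
    simp only [pow_one]
    ring
  · have h₁ := tendsto_sum_zeta (k := i) (by omega)
    have h₂ := (tendsto_add_atTop_iff_nat n).2 h₁
    convert h₁.add (h₂.const_mul ((-1) ^ i)) using 2
    rw [evenZeta]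
    split_ifs with h
    · rw [h.neg_one_pow]; ring
    · rw [(Nat.not_even_iff_odd.1 h).neg_one_pow]; ring

lemma tendsto_principalValue' {i : ℕ} (hi : 1 ≤ i) (n : ℕ) :
    Tendsto (fun M => ∑ j ∈ range (M + n), ((j : ℝ) + 1)⁻¹ ^ i
      + (-1) ^ i * ∑ j ∈ range M, ((j : ℝ) + 1)⁻¹ ^ i) atTop (𝓝 (evenZeta i)) := by
  have hsq : (-1 : ℝ) ^ i * (-1) ^ i = 1 := by rw [← mul_pow]; simp
  have hE : (-1 : ℝ) ^ i * evenZeta i = evenZeta i := by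
    rw [evenZeta]
    split_ifs with h
    · rw [h.neg_one_pow, one_mul]
    · rw [mul_zero]
  rw [← hE]
  refine ((tendsto_principalValue hi n).const_mul ((-1) ^ i)).congr fun M => ?_
  linear_combination (∑ j ∈ range (M + n), ((j : ℝ) + 1)⁻¹ ^ i) * hsq

/-- The principal value of the sum of `polarPart r s c j` over the nonzero integers `j`. -/
noncomputable def polarSum (r s : ℕ) (c : ℝ) : ℝ :=
  ∑ t ∈ range r, (-1 : ℝ) ^ t * (s.multichoose t : ℝ) * c⁻¹ ^ (s + t) * evenZeta (r - t)

lemma neg_inv_pow (x : ℝ) (m : ℕ) : (-x)⁻¹ ^ m = (-1) ^ m * x⁻¹ ^ m := by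
  rw [inv_neg, neg_pow]

lemma sum_polarPart_add_sum_neg (r s : ℕ) (c : ℝ) (A B : ℕ) :
    ∑ j ∈ range A, polarPart r s c ((j : ℝ) + 1) + ∑ j ∈ range B, polarPart r s c (-((j : ℝ) + 1))
      = ∑ t ∈ range r, (-1 : ℝ) ^ t * (s.multichoose t : ℝ) * c⁻¹ ^ (s + t) *
        (∑ j ∈ range A, ((j : ℝ) + 1)⁻¹ ^ (r - t)
          + (-1) ^ (r - t) * ∑ j ∈ range B, ((j : ℝ) + 1)⁻¹ ^ (r - t)) := by
  simp only [polarPart]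
  rw [Finset.sum_comm, Finset.sum_comm (s := range B), ← Finset.sum_add_distrib]
  refine Finset.sum_congr rfl fun t _ => ?_
  simp only [neg_inv_pow, mul_add, Finset.mul_sum]

lemma tendsto_sum_polarPart (r s : ℕ) (c : ℝ) (n : ℕ) :
    Tendsto (fun M => ∑ j ∈ range M, polarPart r s c ((j : ℝ) + 1)
      + ∑ j ∈ range (M + n), polarPart r s c (-((j : ℝ) + 1))) atTop (𝓝 (polarSum r s c)) := by
  simp only [sum_polarPart_add_sum_neg]
  refine tendsto_finsetSum _ fun t ht => (tendsto_principalValue ?_ n).const_mul _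
  have := Finset.mem_range.1 ht
  omega

lemma tendsto_sum_polarPart' (r s : ℕ) (c : ℝ) (n : ℕ) :
    Tendsto (fun M => ∑ j ∈ range (M + n), polarPart r s c ((j : ℝ) + 1)
      + ∑ j ∈ range M, polarPart r s c (-((j : ℝ) + 1))) atTop (𝓝 (polarSum r s c)) := by
  simp only [sum_polarPart_add_sum_neg]
  refine tendsto_finsetSum _ fun t ht => (tendsto_principalValue' ?_ n).const_mul _
  have := Finset.mem_range.1 ht
  omega

lemma sum_range_split (φ : ℝ → ℝ) (n M : ℕ) :
    ∑ j ∈ range (M + (n + 1)), φ ((j : ℝ) + 1)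
      = ∑ q ∈ range n, φ ((q : ℝ) + 1) + φ ((n : ℝ) + 1)
        + ∑ p ∈ range M, φ ((p : ℝ) + n + 2) := by
  rw [add_comm M, Finset.sum_range_add, Finset.sum_range_succ]
  congr 1
  refine Finset.sum_congr rfl fun p _ => ?_
  push_cast
  congr 1
  ring

lemma shifted_sums_eq_sum_polarPart {r s : ℕ} (hr : 1 ≤ r) (n M : ℕ) :
    ∑ j ∈ range M, ((j : ℝ) + 1)⁻¹ ^ r * ((j : ℝ) + n + 2)⁻¹ ^ s + (-1) ^ r * convSum r s n
        + (-1) ^ (r + s) * ∑ j ∈ range M, ((j : ℝ) + 1)⁻¹ ^ s * ((j : ℝ) + n + 2)⁻¹ ^ r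
      = (∑ j ∈ range M, polarPart r s ((n : ℝ) + 1) ((j : ℝ) + 1)
          + ∑ j ∈ range (M + (n + 1)), polarPart r s ((n : ℝ) + 1) (-((j : ℝ) + 1)))
        + (∑ j ∈ range (M + (n + 1)), polarPart s r (-((n : ℝ) + 1)) ((j : ℝ) + 1)
          + ∑ j ∈ range M, polarPart s r (-((n : ℝ) + 1)) (-((j : ℝ) + 1)))
        - polarPart r s ((n : ℝ) + 1) (-((n : ℝ) + 1))
        - polarPart s r (-((n : ℝ) + 1)) ((n : ℝ) + 1) := by
  have hc : (n : ℝ) + 1 ≠ 0 := by positivity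
  have h₁ : ∑ j ∈ range M, ((j : ℝ) + 1)⁻¹ ^ r * ((j : ℝ) + n + 2)⁻¹ ^ s
      = ∑ j ∈ range M, polarPart r s ((n : ℝ) + 1) ((j : ℝ) + 1)
        + ∑ j ∈ range M, polarPart s r (-((n : ℝ) + 1)) ((j : ℝ) + n + 2) := by
    rw [← Finset.sum_add_distrib]
    refine Finset.sum_congr rfl fun j _ => ?_
    exact inv_pow_mul_inv_pow_eq_polarPart hc (by positivity) (by positivity) (by ring) _ _
      (by omega)
  have h₂ : (-1) ^ r * convSum r s n
      = ∑ q ∈ range n, polarPart r s ((n : ℝ) + 1) (-((q : ℝ) + 1))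
        + ∑ q ∈ range n, polarPart s r (-((n : ℝ) + 1)) ((q : ℝ) + 1) := by
    rw [← Finset.sum_range_reflect (fun q : ℕ => polarPart s r (-((n : ℝ) + 1)) ((q : ℝ) + 1)),
      ← Finset.sum_add_distrib, convSum, Finset.mul_sum]
    refine Finset.sum_congr rfl fun q hq => ?_
    have hx : -((q : ℝ) + 1) ≠ 0 := neg_ne_zero.2 (by positivity)
    have hsub : ((n - 1 - q : ℕ) : ℝ) = n - 1 - q := by
      have := Finset.mem_range.1 hq
      rw [Nat.sub_sub, Nat.cast_sub (by omega)]
      push_cast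
      ring
    rw [← inv_pow_mul_inv_pow_eq_polarPart hc hx (by positivity) (by rw [hsub]; ring) _ _
      (by omega), neg_inv_pow, mul_assoc]
  have h₃ : (-1) ^ (r + s) * ∑ j ∈ range M, ((j : ℝ) + 1)⁻¹ ^ s * ((j : ℝ) + n + 2)⁻¹ ^ r
      = ∑ j ∈ range M, polarPart r s ((n : ℝ) + 1) (-((j : ℝ) + n + 2))
        + ∑ j ∈ range M, polarPart s r (-((n : ℝ) + 1)) (-((j : ℝ) + 1)) := by
    rw [← Finset.sum_add_distrib, Finset.mul_sum]
    refine Finset.sum_congr rfl fun j _ => ?_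
    rw [← inv_pow_mul_inv_pow_eq_polarPart hc (neg_ne_zero.2 (by positivity))
      (neg_ne_zero.2 (by positivity)) (by ring) _ _ (by omega), neg_inv_pow, neg_inv_pow]
    ring
  rw [h₁, h₂, h₃, sum_range_split (fun x => polarPart r s ((n : ℝ) + 1) (-x)),
    sum_range_split (polarPart s r (-((n : ℝ) + 1)))]
  ring

lemma shiftedSum_relation {r s : ℕ} (hr : 1 ≤ r) (hs : 1 ≤ s) (n : ℕ) :
    shiftedSum r s n + (-1) ^ r * convSum r s n + (-1) ^ (r + s) * shiftedSum s r n
      = polarSum r s ((n : ℝ) + 1) + polarSum s r (-((n : ℝ) + 1))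
        - polarPart r s ((n : ℝ) + 1) (-((n : ℝ) + 1))
        - polarPart s r (-((n : ℝ) + 1)) ((n : ℝ) + 1) := by
  have h₁ := (summable_shiftedSum (r := r) (s := s) (by omega) n).hasSum.tendsto_sum_nat
  have h₂ := (summable_shiftedSum (r := s) (s := r) (by omega) n).hasSum.tendsto_sum_nat
  have h₃ := (((tendsto_sum_polarPart r s ((n : ℝ) + 1) (n + 1)).add
    (tendsto_sum_polarPart' s r (-((n : ℝ) + 1)) (n + 1))).sub_const
    (polarPart r s ((n : ℝ) + 1) (-((n : ℝ) + 1)))).sub_const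
    (polarPart s r (-((n : ℝ) + 1)) ((n : ℝ) + 1))
  refine tendsto_nhds_unique ((h₁.add_const _).add (h₂.const_mul _)) (h₃.congr fun M => ?_)
  exact (shifted_sums_eq_sum_polarPart hr n M).symm

lemma polarSum_eq {r s h : ℕ} (hs : 1 ≤ s) (hrs : r + s = 2 * h + 1) (c : ℝ) :
    polarSum r s c = (-1) ^ r * ∑ l ∈ range h, ((2 * h + 1 - 2 * (l + 1) - 1).choose (s - 1) : ℝ)
      * (2 * zeta (2 * (l + 1))) * c⁻¹ ^ (2 * h + 1 - 2 * (l + 1)) := by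
  set φ : ℕ → ℝ := fun i => ((2 * h + 1 - (i + 1) - 1).choose (s - 1) : ℝ) * evenZeta (i + 1)
    * c⁻¹ ^ (2 * h + 1 - (i + 1)) with hφ
  have hpair (m : ℕ) : ∑ i ∈ range (2 * m), φ i
      = ∑ l ∈ range m, (φ (2 * l) + φ (2 * l + 1)) := by
    induction m with
    | zero => simp
    | succ m ih =>
      rw [show 2 * (m + 1) = 2 * m + 1 + 1 by ring, Finset.sum_range_succ, Finset.sum_range_succ,
        Finset.sum_range_succ _ m, ih, add_assoc]
  have h₁ : polarSum r s c = (-1) ^ r * ∑ i ∈ range r, φ i := by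
    rw [polarSum, ← Finset.sum_range_reflect, Finset.mul_sum]
    refine Finset.sum_congr rfl fun i hi => ?_
    obtain ⟨u, rfl⟩ := Nat.exists_eq_add_of_lt (Finset.mem_range.1 hi)
    have hu : i + u + 1 - 1 - i = u := by omega
    have e₁ : i + u + 1 - u = i + 1 := by omega
    have e₂ : 2 * h + 1 - (i + 1) = s + u := by omega
    have hM : s.multichoose u = (s + u - 1).choose (s - 1) := by
      rw [Nat.multichoose_eq]
      exact Nat.choose_symm_of_eq_add (by omega)
    simp only [hφ, hu, e₁, e₂, hM]
    rw [evenZeta]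
    split_ifs with he
    · rw [show i + u + 1 = u + (i + 1) by ring, pow_add (-1 : ℝ) u, he.neg_one_pow]
      ring
    · ring
  have h₂ : ∑ i ∈ range r, φ i = ∑ i ∈ range (2 * h), φ i := by
    refine Finset.sum_subset (Finset.range_subset_range.2 (by omega)) fun i hi hi' => ?_
    simp only [Finset.mem_range] at hi hi'
    simp only [hφ]
    rw [Nat.choose_eq_zero_of_lt (by omega)]
    simp
  rw [h₁, h₂, hpair]
  congr 1
  refine Finset.sum_congr rfl fun l _ => ?_
  have ho : ¬ Even (2 * l + 1) := by simp
  have he : Even (2 * (l + 1)) := by simp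
  simp only [hφ]
  rw [show 2 * l + 1 + 1 = 2 * (l + 1) by ring]
  rw [evenZeta, evenZeta, if_neg ho, if_pos he]
  ring

lemma shiftedSum_sub_swap_add_convSum {r s h : ℕ} (hr : 1 ≤ r) (hs : 1 ≤ s)
    (hrs : r + s = 2 * h + 1) (n : ℕ) :
    shiftedSum r s n - shiftedSum s r n + (-1) ^ r * convSum r s n
      = 2 * (-1) ^ r * ∑ l ∈ range (h + 1), (((2 * h + 1 - 2 * l - 1).choose (r - 1) : ℝ)
        + ((2 * h + 1 - 2 * l - 1).choose (s - 1) : ℝ)) * zeta (2 * l)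
          * ((n : ℝ) + 1)⁻¹ ^ (2 * h + 1 - 2 * l) := by
  have hodd : Odd (2 * h + 1) := by simp
  have hsign : (-1 : ℝ) ^ s = -(-1) ^ r := by
    have h₁ : (-1 : ℝ) ^ r * (-1) ^ s = -1 := by rw [← pow_add, hrs, hodd.neg_one_pow]
    have h₂ : (-1 : ℝ) ^ r * (-1) ^ r = 1 := by rw [← mul_pow]; simp
    linear_combination (-1 : ℝ) ^ r * h₁ - (-1 : ℝ) ^ s * h₂
  have hrel := shiftedSum_relation hr hs n
  have hp₁ := polarPart_neg_self (s := s) hr ((n : ℝ) + 1)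
  have hp₂ := polarPart_neg_self (s := r) hs (-((n : ℝ) + 1))
  have hz : zeta 0 = -1 / 2 := by simp [zeta]
  rw [add_comm s r, neg_neg, hrs] at hp₂
  rw [hrs] at hp₁
  rw [hrs, hodd.neg_one_pow, polarSum_eq hs hrs, polarSum_eq (h := h) hr (by omega), hp₁, hp₂] at hrel
  rw [Finset.sum_range_succ', hz]
  have hneg : ∑ l ∈ range h, ((2 * h + 1 - 2 * (l + 1) - 1).choose (r - 1) : ℝ)
        * (2 * zeta (2 * (l + 1))) * (-((n : ℝ) + 1))⁻¹ ^ (2 * h + 1 - 2 * (l + 1))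
      = -∑ l ∈ range h, ((2 * h + 1 - 2 * (l + 1) - 1).choose (r - 1) : ℝ)
        * (2 * zeta (2 * (l + 1))) * ((n : ℝ) + 1)⁻¹ ^ (2 * h + 1 - 2 * (l + 1)) := by
    rw [← Finset.sum_neg_distrib]
    refine Finset.sum_congr rfl fun l hl => ?_
    have : Odd (2 * h + 1 - 2 * (l + 1)) := by
      have := Finset.mem_range.1 hl
      exact ⟨h - (l + 1), by omega⟩
    rw [inv_neg, this.neg_pow]
    ring
  rw [hneg, inv_neg, hodd.neg_pow, hsign] at hrel
  have hsplit : ∑ l ∈ range h, (((2 * h + 1 - 2 * (l + 1) - 1).choose (r - 1) : ℝ)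
        + ((2 * h + 1 - 2 * (l + 1) - 1).choose (s - 1) : ℝ)) * zeta (2 * (l + 1))
          * ((n : ℝ) + 1)⁻¹ ^ (2 * h + 1 - 2 * (l + 1))
      = (∑ l ∈ range h, ((2 * h + 1 - 2 * (l + 1) - 1).choose (r - 1) : ℝ)
        * (2 * zeta (2 * (l + 1))) * ((n : ℝ) + 1)⁻¹ ^ (2 * h + 1 - 2 * (l + 1))
        + ∑ l ∈ range h, ((2 * h + 1 - 2 * (l + 1) - 1).choose (s - 1) : ℝ)
        * (2 * zeta (2 * (l + 1))) * ((n : ℝ) + 1)⁻¹ ^ (2 * h + 1 - 2 * (l + 1))) / 2 := by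
    rw [← Finset.sum_add_distrib, Finset.sum_div]
    exact Finset.sum_congr rfl fun l _ => by ring
  rw [hsplit]
  simp only [Nat.mul_zero, Nat.sub_zero]
  linear_combination hrel

theorem dzetaA3_eval (r s k : ℕ) (hr : 1 ≤ r) (hs : 1 ≤ s) (hk : r + s = k)
    (hk3 : 3 ≤ k) (hodd : Odd k) :
    dzetaA3 r s = -(1/2) * zeta k + ((1 + (-1 : ℝ)^s)/2) * zetaA r * zetaA s
      + (-1 : ℝ)^r * ∑ l ∈ Finset.range ((k-1)/2 + 1),
          (((k-2*l-1).choose (r-1) : ℝ) + ((k-2*l-1).choose (s-1) : ℝ))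
            * zetaA (k-2*l) * zeta (2*l) := by
  subst hk
  obtain ⟨h, hh⟩ := hodd
  have hD := tendsto_altDoubleSum_and_shiftedSum hr hs
  have hD' := tendsto_altDoubleSum_and_shiftedSum hs hr
  have hshift (f : ℕ → ℝ) (l : ℝ) (hf : Tendsto f atTop (𝓝 l)) :
      Tendsto (fun N => f (N + 1)) atTop (𝓝 l) := (tendsto_add_atTop_iff_nat 1).2 hf
  have stuffle : dzetaA3 r s + dzetaA3 s r + zeta (r + s) = zetaA r * zetaA s :=
    tendsto_nhds_unique
      (((hD.1.add hD'.1).add (hshift _ _ (tendsto_sum_zeta (by omega)))).congr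
        (altDoubleSum_add_swap r s))
      ((hshift _ _ (tendsto_altSum hr)).mul (hshift _ _ (tendsto_altSum hs)))
  have reflection : dzetaA3 r s - dzetaA3 s r + (-1) ^ r * (zetaA r * zetaA s)
      = 2 * (-1) ^ r * ∑ l ∈ range (h + 1), (((2 * h + 1 - 2 * l - 1).choose (r - 1) : ℝ)
        + ((2 * h + 1 - 2 * l - 1).choose (s - 1) : ℝ)) * zeta (2 * l)
          * zetaA (2 * h + 1 - 2 * l) := by
    refine tendsto_nhds_unique ((hD.2.sub hD'.2).add
      ((tendsto_sum_convSum hr hs hk3).const_mul _))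
      ((((tendsto_finsetSum _ fun l hl => (tendsto_altSum (k := 2 * h + 1 - 2 * l)
        (by have := Finset.mem_range.1 hl; omega)).const_mul _)).const_mul _).congr fun N => ?_)
    simp only [altSum, Finset.mul_sum]
    rw [Finset.sum_comm, ← Finset.sum_sub_distrib, ← Finset.sum_add_distrib]
    refine Finset.sum_congr rfl fun n _ => ?_
    have := shiftedSum_sub_swap_add_convSum hr hs hh n
    rw [Finset.mul_sum] at this
    have h' : (-1 : ℝ) ^ (n + 1) * shiftedSum r s n - (-1) ^ (n + 1) * shiftedSum s r n
        + (-1) ^ r * ((-1) ^ (n + 1) * convSum r s n)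
        = (-1) ^ (n + 1) * (shiftedSum r s n - shiftedSum s r n + (-1) ^ r * convSum r s n) := by
      ring
    rw [h', this, Finset.mul_sum]
    refine Finset.sum_congr rfl fun l _ => ?_
    rw [altTerm_eq]
    ring
  have hsign : (-1 : ℝ) ^ s = -(-1) ^ r := by
    have h₁ : (-1 : ℝ) ^ r * (-1) ^ s = -1 := by rw [← pow_add, hh]; simp [pow_succ]
    have h₂ : (-1 : ℝ) ^ r * (-1) ^ r = 1 := by rw [← mul_pow]; simp
    linear_combination (-1 : ℝ) ^ r * h₁ - (-1 : ℝ) ^ s * h₂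
  simp only [mul_right_comm _ (zeta _) (zetaA _)] at reflection
  rw [hh] at stuffle ⊢
  rw [hsign, show (2 * h + 1 - 1) / 2 = h by omega]
  linear_combination (stuffle + reflection) / 2
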